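/- Let x* ∈ ℝ^d have at most s nonzero entries. Then every x ∈ ℝ^d with ‖x‖₁ ≤ ‖x*‖₁ satisfies ‖x − x*‖₁ ≤ 2·√s·‖x − x*‖₂. -/

import Mathlib

/-- Euclidean (ℓ₂) norm of a vector. -/
noncomputable def l2norm {k : ℕ} (v : Fin k → ℝ) : ℝ := Real.sqrt (∑ i, (v i) ^ 2)

/-- the ℓ₁-ball tangent-cone inequality at an s-sparse vector:
if ‖x‖₁ ≤ ‖x*‖₁ and x* has at most s nonzero entries, then
‖x − x*‖₁ ≤ 2√s·‖x − x*‖₂. -/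
theorem sparse_cone_inequality
    {d s : ℕ} (xstar : Fin d → ℝ)
    (hs : Set.ncard {j | xstar j ≠ 0} ≤ s)
    (x : Fin d → ℝ) (hx : ∑ j, |x j| ≤ ∑ j, |xstar j|) :
    ∑ j, |x j - xstar j| ≤ 2 * Real.sqrt s * l2norm (x - xstar) := by
  classical
  set S : Finset (Fin d) := Finset.univ.filter (fun j => xstar j ≠ 0) with hS
  have hcard : S.card ≤ s := by
    have h : {j | xstar j ≠ 0} = (S : Set (Fin d)) := by ext j; simp [hS]
    rw [h, Set.ncard_coe_finset] at hs
    exact hs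
  have h1 : ∑ j, |x j - xstar j| ≤ 2 * ∑ j ∈ S, |x j - xstar j| := by
    have hp : ∑ j, |x j - xstar j| ≤
        ∑ j, (2 * (if xstar j ≠ 0 then |x j - xstar j| else 0) + (|x j| - |xstar j|)) := by
      refine Finset.sum_le_sum fun j _ => ?_
      by_cases h : xstar j = 0
      · simp [h]
      · have h2 := abs_sub_abs_le_abs_sub (xstar j) (x j)
        rw [abs_sub_comm] at h2
        simp only [ne_eq, h, not_false_eq_true, if_true]
        linarith
    rw [Finset.sum_add_distrib, ← Finset.mul_sum, Finset.sum_sub_distrib,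
      ← Finset.sum_filter] at hp
    linarith
  have h2 : ∑ j ∈ S, |x j - xstar j| ≤ Real.sqrt s * l2norm (x - xstar) := by
    unfold l2norm
    rw [← Real.sqrt_mul (Nat.cast_nonneg s)]
    apply Real.le_sqrt_of_sq_le
    calc (∑ j ∈ S, |x j - xstar j|) ^ 2
        ≤ (S.card : ℝ) * ∑ j ∈ S, |x j - xstar j| ^ 2 := sq_sum_le_card_mul_sum_sq
      _ ≤ (s : ℝ) * ∑ j, ((x - xstar) j) ^ 2 := by
        have h3 : ∑ j ∈ S, |x j - xstar j| ^ 2 ≤ ∑ j, ((x - xstar) j) ^ 2 := by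
          simp only [sq_abs, Pi.sub_apply]
          exact Finset.sum_le_sum_of_subset_of_nonneg (Finset.subset_univ _)
            fun _ _ _ => sq_nonneg _
        have h4 : (S.card : ℝ) ≤ s := by exact_mod_cast hcard
        exact mul_le_mul h4 h3 (Finset.sum_nonneg fun _ _ => sq_nonneg _) (Nat.cast_nonneg s)
  linarith
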